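/- For π, π′ in the weak order interval [e,ω] of S_n, one has π ≡_ω π′ if and only if there is a sequence π = σ_0, σ_1, …, σ_r = π′ of permutations in [e,ω] such that for each step s, the one-line notations of σ_s and σ_{s+1} have the form U i j V and U j i V (in either order) for some values i < j and words U, V, subject to the condition #{k ∈ U : k > i} ≥ #{k ∈ U : ω⁻¹(k) < ω⁻¹(j)}. In other words, on [e,ω] the pipe dream congruence ≡_ω is the transitive closure of the rewriting rule U i j V ≡_ω U j i V under this condition. -/

import Mathlib

/-- A pipe dream of size `n` on the triangular shape, with boxes indexed by pairs
`(r, c)` of a row `r` and a column `c`, both `0`-indexed (rows increase southwards,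
columns increase eastwards).  `cross r c = true` means that box `(r, c)` contains a
crossing tile; all other boxes contain elbow tiles.  Crossings are only allowed in
the full boxes of the triangular shape, i.e. those with `r + c + 2 ≤ n` (the boxes
with `r + c + 1 = n` are the half-boxes on the antidiagonal, which are forced
elbows).  The `n` pipes enter horizontally on the left side in rows `0, …, n-1` and
exit vertically on the top side in columns `0, …, n-1`; pipe `k` is the pipe
entering at row `k`.  An elbow tile connects the west edge of its box to the north
edge (the pipe travelling through this elbow passes northwest of the tile) and the
south edge to the east edge (this pipe passes southeast of the tile); a crossing
tile connects west to east and south to north. -/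
structure PipeDream (n : ℕ) where
  cross : ℕ → ℕ → Bool
  inShape : ∀ r c : ℕ, cross r c = true → r + c + 2 ≤ n

namespace PipeDream

variable {n : ℕ}

/-- `(P.pipes r c).1` is the label of the pipe entering box `(r, c)` from the west,
and `(P.pipes r c).2` is the label of the pipe entering box `(r, c)` from the south
(junk value `0` if there is no box below box `(r, c)` in the triangular shape). -/
def pipes (P : PipeDream n) : ℕ → ℕ → ℕ × ℕ
  | r, c =>
    (if hc : c = 0 then r
      else if P.cross r (c - 1) then (pipes P r (c - 1)).1 else (pipes P r (c - 1)).2,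
     if hr : r + c + 2 ≤ n then
        if P.cross (r + 1) c then (pipes P (r + 1) c).2 else (pipes P (r + 1) c).1
      else 0)
  termination_by r c => (n - r) + c
  decreasing_by all_goals omega

/-- The pipe entering box `(r, c)` from the west (travelling eastwards). -/
def west (P : PipeDream n) (r c : ℕ) : ℕ := (pipes P r c).1

/-- The pipe entering box `(r, c)` from the south (travelling northwards). -/
def south (P : PipeDream n) (r c : ℕ) : ℕ := (pipes P r c).2

/-- The pipe exiting on the top side at column `c`. -/
def exitPipe (P : PipeDream n) (c : ℕ) : ℕ :=
  if P.cross 0 c then P.south 0 c else P.west 0 c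

/-- `P` has exit permutation `ω`, i.e. the pipe exiting at column `c` is `ω c`;
equivalently, pipe `k` exits at column `ω⁻¹ k`. -/
def HasExitPerm (P : PipeDream n) (ω : Equiv.Perm (Fin n)) : Prop :=
  ∀ c : Fin n, P.exitPipe c.val = (ω c).val

/-- `P` is reduced: any two of its pipes cross at most once. -/
def Reduced (P : PipeDream n) : Prop :=
  ∀ r c r' c' : ℕ, P.cross r c = true → P.cross r' c' = true → (r, c) ≠ (r', c') →
    ¬ ((P.west r c = P.west r' c' ∧ P.south r c = P.south r' c') ∨
        (P.west r c = P.south r' c' ∧ P.south r c = P.west r' c'))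

/-- The arcs of the contact graph `P♯` of `P`: there is one arc for each elbow
contact of `P` (an elbow tile in a full box of the triangular shape), oriented from
the pipe passing northwest of the contact (the one travelling west-to-north) to the
pipe passing southeast of it (the one travelling south-to-east). -/
def Arc (P : PipeDream n) (i j : ℕ) : Prop :=
  ∃ r c : ℕ, r + c + 2 ≤ n ∧ P.cross r c = false ∧ P.west r c = i ∧ P.south r c = j

/-- `P` is acyclic: its contact graph has no directed cycle. -/
def Acyclic (P : PipeDream n) : Prop := ∀ i : ℕ, ¬ Relation.TransGen P.Arc i i

/-- `i ⪯_P j` : there is a directed path (possibly empty) from `i` to `j` in the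
contact graph of `P`. -/
def Path (P : PipeDream n) (i j : ℕ) : Prop := Relation.ReflTransGen P.Arc i j

/-- `π` is a linear extension of `P` : `π⁻¹ i < π⁻¹ j` for every arc `i → j` of the
contact graph of `P`. -/
def LinExt (P : PipeDream n) (π : Equiv.Perm (Fin n)) : Prop :=
  ∀ i j : Fin n, P.Arc i.val j.val → π⁻¹ i < π⁻¹ j

/-- There is a contact (an elbow tile in a full box) between pipes `i` and `j`
at box `b`. -/
def ContactAt (P : PipeDream n) (i j : ℕ) (b : ℕ × ℕ) : Prop :=
  b.1 + b.2 + 2 ≤ n ∧ P.cross b.1 b.2 = false ∧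
    ((P.west b.1 b.2 = i ∧ P.south b.1 b.2 = j) ∨
      (P.west b.1 b.2 = j ∧ P.south b.1 b.2 = i))

/-- `P'` is obtained from `P` by the flip exchanging the contact at box `b` with the
crossing at box `b'` (a contact and a crossing between the same two pipes). -/
def IsFlip (P P' : PipeDream n) (b b' : ℕ × ℕ) : Prop :=
  b ≠ b' ∧
  P.cross b.1 b.2 = false ∧ P.cross b'.1 b'.2 = true ∧
  P'.cross b.1 b.2 = true ∧ P'.cross b'.1 b'.2 = false ∧
  (∀ r c : ℕ, (r, c) ≠ b → (r, c) ≠ b' → P.cross r c = P'.cross r c) ∧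
  ((P.west b.1 b.2 = P.west b'.1 b'.2 ∧ P.south b.1 b.2 = P.south b'.1 b'.2) ∨
    (P.west b.1 b.2 = P.south b'.1 b'.2 ∧ P.south b.1 b.2 = P.west b'.1 b'.2))

/-- There is an increasing flip from `P` to `P'`: a flip exchanging a contact at a
box `b` weakly southwest of the box `b'` of the corresponding crossing. -/
def IncFlip (P P' : PipeDream n) : Prop :=
  ∃ b b' : ℕ × ℕ, P.IsFlip P' b b' ∧ b'.1 ≤ b.1 ∧ b.2 ≤ b'.2

end PipeDream

/-- The weak order on permutations of `Fin n` : `π ≤ σ` if and only if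
`Inv(π) ⊆ Inv(σ)`, where `Inv(π)` is the set of pairs `(i, j)` with `i < j` and
`π⁻¹ i > π⁻¹ j`. -/
def WeakLE {n : ℕ} (π σ : Equiv.Perm (Fin n)) : Prop :=
  ∀ i j : Fin n, i < j → π⁻¹ j < π⁻¹ i → σ⁻¹ j < σ⁻¹ i

/-- Two permutations of `[e, ω]` are equivalent for the pipe dream congruence `≡_ω`
if they are linear extensions of the same acyclic pipe dream of `Π(ω)`. -/
def PDEquiv {n : ℕ} (ω : Equiv.Perm (Fin n)) (a b : Equiv.Perm (Fin n)) : Prop :=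
  ∃ P : PipeDream n,
    P.Reduced ∧ P.HasExitPerm ω ∧ P.Acyclic ∧ P.LinExt a ∧ P.LinExt b

/-- One application of the rewriting rule `U i j V ⟶ U j i V`, where `i < j` and
`#{k ∈ U : k > i} ≥ #{k ∈ U : ω⁻¹ k < ω⁻¹ j}` : here `σ = U i j V` (one-line
notation, with `i` at position `p` and `j` at position `p + 1`) and `τ = U j i V`,
and `U` consists of the first `p` entries of `σ`. -/
def RewStep {n : ℕ} (ω : Equiv.Perm (Fin n)) (σ τ : Equiv.Perm (Fin n)) : Prop :=
  ∃ (p : ℕ) (hp : p + 1 < n) (i j : Fin n), i < j ∧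
    σ ⟨p, Nat.lt_of_succ_lt hp⟩ = i ∧ σ ⟨p + 1, hp⟩ = j ∧
    τ = σ * Equiv.swap ⟨p, Nat.lt_of_succ_lt hp⟩ ⟨p + 1, hp⟩ ∧
    (Finset.univ.filter (fun q : Fin n => q.val < p ∧ ω⁻¹ (σ q) < ω⁻¹ j)).card ≤
      (Finset.univ.filter (fun q : Fin n => q.val < p ∧ i < σ q)).card


namespace PipeDream

/-- The pipe leaving box `(r, c)` through its north edge. -/
def north {n : ℕ} (P : PipeDream n) (r c : ℕ) : ℕ :=
  if P.cross r c then P.south r c else P.west r c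

theorem west_zero {n : ℕ} (P : PipeDream n) (r : ℕ) : P.west r 0 = r := by
  unfold west; rw [pipes]; simp

theorem west_succ {n : ℕ} (P : PipeDream n) (r c : ℕ) :
    P.west r (c + 1) = if P.cross r c then P.west r c else P.south r c := by
  unfold west south; rw [pipes]; simp

theorem south_eq {n : ℕ} (P : PipeDream n) (r c : ℕ) (h : r + c + 2 ≤ n) :
    P.south r c = P.north (r + 1) c := by
  unfold north west south; rw [pipes]; simp [h]

theorem exit_eq {n : ℕ} (P : PipeDream n) (c : ℕ) : P.exitPipe c = P.north 0 c := rfl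

theorem north_cross {n : ℕ} (P : PipeDream n) {r c : ℕ} (h : P.cross r c = true) :
    P.north r c = P.south r c := by simp [north, h]

theorem north_elbow {n : ℕ} (P : PipeDream n) {r c : ℕ} (h : P.cross r c = false) :
    P.north r c = P.west r c := by simp [north, h]

theorem west_cross {n : ℕ} (P : PipeDream n) {r c : ℕ} (h : P.cross r c = true) :
    P.west r (c + 1) = P.west r c := by simp [west_succ, h]

theorem west_elbow {n : ℕ} (P : PipeDream n) {r c : ℕ} (h : P.cross r c = false) :
    P.west r (c + 1) = P.south r c := by simp [west_succ, h]

theorem elbow_of {n : ℕ} (P : PipeDream n) {r c : ℕ} (h : ¬ r + c + 2 ≤ n) :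
    P.cross r c = false := by
  by_contra hc
  exact h (P.inShape r c (by simpa using hc))

/-- Induction along the pipes: from the south-west to the north-east. -/
theorem box_ind {n : ℕ} {M : ℕ → ℕ → Prop}
    (h : ∀ r c, r + c + 1 ≤ n → (∀ c', c = c' + 1 → M r c') →
      (r + c + 2 ≤ n → M (r + 1) c) → M r c) :
    ∀ r c, r + c + 1 ≤ n → M r c := by
  have key : ∀ m r c, (n - r) + c ≤ m → r + c + 1 ≤ n → M r c := by
    intro m
    induction m with
    | zero => intro r c h1 h2; omega
    | succ m ih =>
      intro r c h1 h2
      refine h r c h2 (fun c' hc' => ih r c' (by omega) (by omega))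
        (fun h3 => ih (r + 1) c (by omega) (by omega))
  exact fun r c hrc => key _ r c le_rfl hrc

/-- Induction against the pipes: from the north-east to the south-west. -/
theorem box_ind_rev {n : ℕ} {M : ℕ → ℕ → Prop}
    (h : ∀ r c, r + c + 1 ≤ n → (∀ r', r = r' + 1 → M r' c) →
      (r + c + 2 ≤ n → M r (c + 1)) → M r c) :
    ∀ r c, r + c + 1 ≤ n → M r c := by
  have key : ∀ m r c, r + (n - c) ≤ m → r + c + 1 ≤ n → M r c := by
    intro m
    induction m with
    | zero => intro r c h1 h2; omega
    | succ m ih =>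
      intro r c h1 h2
      refine h r c h2 (fun c' hc' => ih c' c (by omega) (by omega))
        (fun h3 => ih r (c + 1) (by omega) (by omega))
  exact fun r c hrc => key _ r c le_rfl hrc

theorem bounds {n : ℕ} (P : PipeDream n) : ∀ r c, r + c + 1 ≤ n →
    (r ≤ P.west r c ∧ P.west r c < n) ∧
    (r + c + 2 ≤ n → r + 1 ≤ P.south r c ∧ P.south r c < n) := by
  apply box_ind
  intro r c hrc h1 h2
  constructor
  · rcases c with _ | c
    · rw [west_zero]; omega
    · have := h1 c rfl
      rw [west_succ]
      split_ifs
      · exact this.1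
      · have := this.2 (by omega); omega
  · intro hf
    have := h2 hf
    rw [south_eq P r c hf, north]
    split_ifs with hx
    · have := this.2 (P.inShape _ _ hx); omega
    · exact this.1

theorem exits {n : ℕ} (P : PipeDream n) : ∀ r c, r + c + 1 ≤ n →
    (∃ c', c ≤ c' ∧ c' < n ∧ P.exitPipe c' = P.west r c) ∧
    (r + c + 2 ≤ n → ∃ c', c ≤ c' ∧ c' < n ∧ P.exitPipe c' = P.south r c) := by
  apply box_ind_rev
  intro r c hrc h1 h2
  have hN : ∃ c', c ≤ c' ∧ c' < n ∧ P.exitPipe c' = P.north r c := by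
    rcases r with _ | r
    · exact ⟨c, le_rfl, by omega, rfl⟩
    · rw [← south_eq P r c (by omega)]
      exact (h1 r rfl).2 (by omega)
  have hE : r + c + 2 ≤ n → ∃ c', c ≤ c' ∧ c' < n ∧ P.exitPipe c' = P.west r (c + 1) := by
    intro hf
    obtain ⟨c', h3, h4, h5⟩ := (h2 hf).1
    exact ⟨c', by omega, h4, h5⟩
  cases hx : P.cross r c with
  | true =>
    rw [north_cross P hx] at hN
    rw [west_cross P hx] at hE
    exact ⟨hE (P.inShape _ _ hx), fun _ => hN⟩
  | false =>
    rw [north_elbow P hx] at hN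
    rw [west_elbow P hx] at hE
    exact ⟨hN, hE⟩

theorem fwd {n : ℕ} (P : PipeDream n) (r : ℕ) : ∀ m c, n - c ≤ m → r + c + 1 ≤ n →
    (∃ c', r + c' + 1 ≤ n ∧ P.north r c' = P.west r c) ∧
    (r + c + 2 ≤ n → ∃ c', r + c' + 1 ≤ n ∧ P.north r c' = P.south r c) := by
  intro m
  induction m with
  | zero => intro c h1 h2; omega
  | succ m ih =>
    intro c h1 h2
    cases hx : P.cross r c with
    | true =>
      have hf := P.inShape _ _ hx
      have := (ih (c + 1) (by omega) (by omega)).1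
      rw [west_cross P hx] at this
      exact ⟨this, fun _ => ⟨c, h2, north_cross P hx⟩⟩
    | false =>
      refine ⟨⟨c, h2, north_elbow P hx⟩, fun hf => ?_⟩
      have := (ih (c + 1) (by omega) (by omega)).1
      rwa [west_elbow P hx] at this

theorem north_surj {n : ℕ} (P : PipeDream n) (y : ℕ) (hy : y < n) : ∀ k r, r + k = y →
    ∃ c, r + c + 1 ≤ n ∧ P.north r c = y := by
  intro k
  induction k with
  | zero =>
    intro r hr
    have := (P.fwd r _ 0 le_rfl (by omega)).1
    rw [west_zero] at this
    simpa [← hr] using this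
  | succ k ih =>
    intro r hr
    obtain ⟨c, h1, h2⟩ := ih (r + 1) (by omega)
    rw [← south_eq P r c (by omega)] at h2
    rw [← h2]
    exact (P.fwd r _ c le_rfl (by omega)).2 (by omega)

theorem inj_of_surj (m : ℕ) (f g : ℕ → ℕ) (hg : ∀ k < m, ∀ l < m, g k = g l → k = l)
    (hs : ∀ k < m, ∃ c < m, f c = g k) :
    ∀ c < m, ∀ d < m, f c = f d → c = d := by
  classical
  have hsub : (Finset.range m).image g ⊆ (Finset.range m).image f := by
    intro y hy
    simp only [Finset.mem_image, Finset.mem_range] at hy ⊢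
    obtain ⟨k, hk, rfl⟩ := hy
    exact hs k hk
  have h1 : ((Finset.range m).image g).card = m := by
    rw [Finset.card_image_of_injOn, Finset.card_range]
    intro k hk l hl h
    exact hg k (by simpa using hk) l (by simpa using hl) h
  have h2 : ((Finset.range m).image f).card = (Finset.range m).card := by
    apply le_antisymm Finset.card_image_le
    have := Finset.card_le_card hsub
    rw [h1] at this
    simpa using this
  have := Finset.card_image_iff.mp h2
  intro c hc d hd h
  exact this (by simpa using hc) (by simpa using hd) h

theorem north_inj {n : ℕ} (P : PipeDream n) (r : ℕ) {c d : ℕ} (hc : r + c + 1 ≤ n)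
    (hd : r + d + 1 ≤ n) (h : P.north r c = P.north r d) : c = d := by
  refine inj_of_surj (n - r) (fun c => P.north r c) (fun k => r + k) (by intros; omega) ?_
    c (by omega) d (by omega) h
  intro k hk
  obtain ⟨c, h1, h2⟩ := P.north_surj (r + k) (by omega) k r rfl
  exact ⟨c, by omega, h2⟩

theorem back {n : ℕ} (P : PipeDream n) (b : ℕ) : ∀ r c, r + c + 1 ≤ n → b ≤ c →
    (∃ r', r' + b + 1 ≤ n ∧ P.west r' b = P.west r c) ∧
    (r + c + 2 ≤ n → ∃ r', r' + b + 1 ≤ n ∧ P.west r' b = P.south r c) := by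
  apply box_ind
  intro r c hrc h1 h2 hb
  constructor
  · rcases Nat.eq_or_lt_of_le hb with rfl | hb
    · exact ⟨r, hrc, rfl⟩
    rcases c with _ | c
    · omega
    · have := h1 c rfl (by omega)
      rw [west_succ]
      split_ifs
      · exact this.1
      · exact this.2 (by omega)
  · intro hf
    have := h2 hf hb
    rw [south_eq P r c hf, north]
    split_ifs with hx
    · exact this.2 (P.inShape _ _ hx)
    · exact this.1

theorem west_inj {n : ℕ} (P : PipeDream n) (b : ℕ) {r s : ℕ} (hr : r + b + 1 ≤ n)
    (hs : s + b + 1 ≤ n) (h : P.west r b = P.west s b) : r = s := by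
  refine inj_of_surj (n - b) (fun r => P.west r b) (fun k => P.north 0 (b + k)) ?_ ?_
    r (by omega) s (by omega) h
  · intro k hk l hl h
    have := P.north_inj 0 (by omega) (by omega) h
    omega
  · intro k hk
    have := P.back b 0 (b + k) (by omega) (by omega)
    unfold north
    split_ifs with hx
    · obtain ⟨r, h1, h2⟩ := this.2 (P.inShape _ _ hx)
      exact ⟨r, by omega, h2⟩
    · obtain ⟨r, h1, h2⟩ := this.1
      exact ⟨r, by omega, h2⟩

theorem arc_lt {n : ℕ} (P : PipeDream n) {i j : ℕ} (h : P.Arc i j) : i < n ∧ j < n := by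
  obtain ⟨r, c, hf, -, rfl, rfl⟩ := h
  have := P.bounds r c (by omega)
  exact ⟨this.1.2, (this.2 hf).2⟩

/-- Pipe `v` is southeast of all its contacts; it exits in column `d`. -/
structure SinkAt {n : ℕ} (P : PipeDream (n + 1)) (v d : ℕ) : Prop where
  hv : v ≤ n
  hd : d ≤ n
  hvd : n ≤ v + d
  row : ∀ c, v + c + 1 ≤ n → P.cross v c = true
  col : ∀ r, r + d + 1 ≤ n → P.cross r d = true
  diag : ∀ r c, r < v → c < d → r + c + 1 = n → P.cross r c = false

theorem row_path {n : ℕ} (P : PipeDream (n + 1)) (v : ℕ)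
    (row : ∀ c, v + c + 1 ≤ n → P.cross v c = true) : ∀ c, v + c ≤ n → P.west v c = v := by
  intro c
  induction c with
  | zero => intro _; exact P.west_zero v
  | succ c ih =>
    intro h
    rw [west_cross P (row c (by omega))]
    exact ih (by omega)

theorem diag_path {n : ℕ} (P : PipeDream (n + 1)) (v d : ℕ) (hv : v ≤ n)
    (row : ∀ c, v + c + 1 ≤ n → P.cross v c = true)
    (diag : ∀ r c, r < v → c < d → r + c + 1 = n → P.cross r c = false) :
    ∀ k r c, r + k = v → c ≤ d → r + c = n → P.west r c = v := by
  intro k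
  induction k with
  | zero =>
    intro r c h1 _ h2
    obtain rfl : r = v := by omega
    exact P.row_path r row c (by omega)
  | succ k ih =>
    intro r c h1 hc h2
    rcases c with _ | c
    · omega
    · rw [west_elbow P (diag r c (by omega) (by omega) (by omega)),
        south_eq P r c (by omega), north_elbow P (P.elbow_of (by omega))]
      exact ih (r + 1) c (by omega) (by omega) (by omega)

end PipeDream

namespace PipeDream

theorem SinkAt.west_diag {n : ℕ} {P : PipeDream (n + 1)} {v d : ℕ} (S : P.SinkAt v d)
    {r c : ℕ} (hr : r ≤ v) (hc : c ≤ d) (h : r + c = n) : P.west r c = v :=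
  P.diag_path v d S.hv S.row S.diag (v - r) r c (by omega) hc h

theorem SinkAt.south_diag {n : ℕ} {P : PipeDream (n + 1)} {v d : ℕ} (S : P.SinkAt v d)
    {r c : ℕ} (hr : r < v) (hc : c ≤ d) (h : r + c + 1 = n) : P.south r c = v := by
  rw [south_eq P r c (by omega), north_elbow P (P.elbow_of (by omega))]
  exact S.west_diag (by omega) hc (by omega)

theorem SinkAt.south_col {n : ℕ} {P : PipeDream (n + 1)} {v d : ℕ} (S : P.SinkAt v d) :
    ∀ r, r + d + 1 ≤ n → P.south r d = v := by
  have hvd := S.hvd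
  have key : ∀ k r, r + d + 1 + k = n → P.south r d = v := by
    intro k
    induction k with
    | zero => intro r hr; exact S.south_diag (by omega) le_rfl (by omega)
    | succ k ih =>
      intro r hr
      rw [south_eq P r d (by omega), north_cross P (S.col _ (by omega))]
      exact ih (r + 1) (by omega)
  exact fun r hr => key (n - (r + d + 1)) r (by omega)

theorem SinkAt.exit {n : ℕ} {P : PipeDream (n + 1)} {v d : ℕ} (S : P.SinkAt v d) :
    P.exitPipe d = v := by
  rw [exit_eq]
  by_cases h : d + 1 ≤ n
  · rw [north_cross P (S.col 0 (by omega))]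
    exact S.south_col 0 (by omega)
  · rw [north_elbow P (P.elbow_of (by omega))]
    have := S.hd
    exact S.west_diag (by omega) le_rfl (by omega)

theorem trace {n : ℕ} (P : PipeDream (n + 1)) (r d : ℕ)
    (hx : ∀ a, r < a → a + d + 1 ≤ n → P.cross a d = true) :
    ∀ a b, a + b + 1 ≤ n + 1 → r < a → d < b →
    (∃ s, r < s ∧ s + d + 1 ≤ n ∧ P.west s d = P.west a b) ∧
    (a + b + 2 ≤ n + 1 → ∃ s, r < s ∧ s + d + 1 ≤ n ∧ P.west s d = P.south a b) := by
  apply box_ind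
  intro a b hab h1 h2 ha hb
  constructor
  · rcases b with _ | b
    · omega
    rcases Nat.eq_or_lt_of_le (Nat.lt_succ_iff.mp hb) with rfl | hb'
    · exact ⟨a, ha, by omega, (west_cross P (hx a ha (by omega))).symm⟩
    · have := h1 b rfl ha hb'
      rw [west_succ]
      split_ifs
      · exact this.1
      · exact this.2 (by omega)
  · intro hf
    have := h2 hf (by omega) hb
    rw [south_eq P a b hf, north]
    split_ifs with hx
    · exact this.2 (P.inShape _ _ hx)
    · exact this.1

/-- In a reduced pipe dream, a pipe without outgoing arcs has a forced shape. -/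
theorem exists_sinkAt {n : ℕ} (P : PipeDream (n + 1)) (hP : P.Reduced) (v : ℕ) (hv : v ≤ n)
    (hs : ∀ k, ¬ P.Arc v k) : ∃ d, P.SinkAt v d := by
  classical
  have row' : ∀ c, v + c ≤ n → P.west v c = v ∧ (v + c + 1 ≤ n → P.cross v c = true) := by
    have hc : ∀ c, P.west v c = v → v + c + 1 ≤ n → P.cross v c = true := by
      intro c h1 h2
      by_contra hx
      exact hs _ ⟨v, c, by omega, by simpa using hx, h1, rfl⟩
    intro c
    induction c with
    | zero => intro _; exact ⟨P.west_zero v, hc 0 (P.west_zero v)⟩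
    | succ c ih =>
      intro h
      have h1 := ih (by omega)
      have h2 : P.west v (c + 1) = v := by
        rw [west_cross P (h1.2 (by omega))]; exact h1.1
      exact ⟨h2, hc _ h2⟩
  have row : ∀ c, v + c + 1 ≤ n → P.cross v c = true := fun c h => (row' c (by omega)).2 h
  have hex : ∃ d, n ≤ v + d ∧ (d = n ∨ (d + 1 ≤ n ∧ P.cross (n - 1 - d) d = true)) :=
    ⟨n, by omega, Or.inl rfl⟩
  obtain ⟨d, ⟨hvd, hd⟩, hmin⟩ : ∃ d, (n ≤ v + d ∧
      (d = n ∨ (d + 1 ≤ n ∧ P.cross (n - 1 - d) d = true))) ∧ ∀ e < d, ¬ (n ≤ v + e ∧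
      (e = n ∨ (e + 1 ≤ n ∧ P.cross (n - 1 - e) e = true))) :=
    ⟨Nat.find hex, Nat.find_spec hex, fun e he => Nat.find_min hex he⟩
  have hdn : d ≤ n := by omega
  have diag : ∀ r c, r < v → c < d → r + c + 1 = n → P.cross r c = false := by
    intro r c h1 h2 h3
    by_contra hx
    refine hmin c h2 ⟨by omega, Or.inr ⟨by omega, ?_⟩⟩
    obtain rfl : r = n - 1 - c := by omega
    simpa using hx
  have col' : ∀ k r, r + d + 1 + k = n → P.south r d = v ∧
      ∀ a, r ≤ a → a + d + 1 ≤ n → P.cross a d = true := by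
    intro k
    induction k with
    | zero =>
      intro r hr
      constructor
      · rw [south_eq P r d (by omega), north_elbow P (P.elbow_of (by omega))]
        exact P.diag_path v d hv row diag (v - (r + 1)) _ _ (by omega) le_rfl (by omega)
      · intro a h1 h2
        obtain rfl : a = n - 1 - d := by omega
        rcases hd with hd | hd
        · omega
        · exact hd.2
    | succ k ih =>
      intro r hr
      obtain ⟨h1, h2⟩ := ih (r + 1) (by omega)
      have h3 : P.south r d = v := by
        rw [south_eq P r d (by omega), north_cross P (h2 _ le_rfl (by omega))]; exact h1
      refine ⟨h3, fun a ha1 ha2 => ?_⟩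
      rcases Nat.eq_or_lt_of_le ha1 with rfl | ha1
      swap
      · exact h2 a ha1 ha2
      by_contra hx
      have hw : P.west r (d + 1) = v := by
        rw [west_elbow P (by simpa using hx)]; exact h3
      have hx2 : P.cross r (d + 1) = true := by
        by_contra hx2
        exact hs _ ⟨r, d + 1, by omega, by simpa using hx2, hw, rfl⟩
      obtain ⟨hw1, hw2⟩ := P.trace r d (fun a h => h2 a h) (r + 1) (d + 1) (by omega) (by omega)
        (by omega)
      have : ∃ s, r < s ∧ s + d + 1 ≤ n ∧ P.west s d = P.south r (d + 1) := by
        rw [south_eq P r (d + 1) (by omega), north]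
        split_ifs with hx3
        · exact hw2 (P.inShape _ _ hx3)
        · exact hw1
      obtain ⟨s, hs1, hs2, hs3⟩ := this
      have hsouth : ∀ k s, s + d + 1 + k = n → r < s → P.south s d = v := by
        intro k
        induction k with
        | zero =>
          intro s hs1 hs2
          rw [south_eq P s d (by omega), north_elbow P (P.elbow_of (by omega))]
          exact P.diag_path v d hv row diag (v - (s + 1)) _ _ (by omega) le_rfl (by omega)
        | succ k ih =>
          intro s hs1 hs2
          rw [south_eq P s d (by omega), north_cross P (h2 _ (by omega) (by omega))]
          exact ih (s + 1) (by omega) (by omega)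
      have h4 := hsouth (n - (s + d + 1)) s (by omega) hs1
      refine hP r (d + 1) s d hx2 (h2 s hs1 hs2) (by simp) (Or.inr ⟨?_, hs3.symm⟩)
      rw [hw, h4]
  refine ⟨d, hv, hdn, hvd, row, ?_, diag⟩
  intro r hr
  exact (col' (n - (r + d + 1)) r (by omega)).2 r le_rfl hr

/-- The order preserving injection of `ℕ` into itself skipping `v`. -/
def sh (v r : ℕ) : ℕ := if r < v then r else r + 1

theorem sh_lt {v r : ℕ} (h : r < v) : sh v r = r := by simp [sh, h]
theorem sh_ge {v r : ℕ} (h : v ≤ r) : sh v r = r + 1 := by simp [sh, Nat.not_lt.mpr h]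

theorem sh_inj {v r s : ℕ} (h : sh v r = sh v s) : r = s := by
  unfold sh at h; split_ifs at h <;> omega

theorem sh_ne (v r : ℕ) : sh v r ≠ v := by
  unfold sh; split_ifs <;> omega

theorem sh_cases (v r : ℕ) : (r < v ∧ sh v r = r) ∨ (v ≤ r ∧ sh v r = r + 1) := by
  unfold sh; split_ifs <;> omega

theorem exists_sh {v r : ℕ} (h : r ≠ v) : ∃ s, sh v s = r := by
  by_cases h1 : r < v
  · exact ⟨r, sh_lt h1⟩
  · exact ⟨r - 1, by rw [sh_ge (by omega)]; omega⟩

/-- `Q` is obtained from `P` by deleting the sink `v`. -/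
structure Del {n : ℕ} (P : PipeDream (n + 1)) (Q : PipeDream n) (v d : ℕ) : Prop where
  sink : P.SinkAt v d
  rel : ∀ r c, r + c + 2 ≤ n → Q.cross r c = P.cross (sh v r) (sh d c)

theorem Del.elbow {n : ℕ} {P : PipeDream (n + 1)} {Q : PipeDream n} {v d : ℕ}
    (D : Del P Q v d) {r c : ℕ} (h : r + c + 1 = n) : P.cross (sh v r) (sh d c) = false := by
  have h1 := D.sink.hvd
  rcases sh_cases v r with ⟨h2, e2⟩ | ⟨h2, e2⟩ <;> rcases sh_cases d c with ⟨h3, e3⟩ | ⟨h3, e3⟩ <;>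
    rw [e2, e3]
  · exact D.sink.diag r c h2 h3 h
  · exact P.elbow_of (by omega)
  · exact P.elbow_of (by omega)
  · omega

theorem Del.rel' {n : ℕ} {P : PipeDream (n + 1)} {Q : PipeDream n} {v d : ℕ}
    (D : Del P Q v d) {r c : ℕ} (h : r + c + 1 ≤ n) :
    Q.cross r c = P.cross (sh v r) (sh d c) := by
  by_cases hf : r + c + 2 ≤ n
  · exact D.rel r c hf
  · rw [D.elbow (by omega), Q.elbow_of hf]

theorem Del.pipes {n : ℕ} {P : PipeDream (n + 1)} {Q : PipeDream n} {v d : ℕ}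
    (D : Del P Q v d) : ∀ r c, r + c + 1 ≤ n →
    P.west (sh v r) (sh d c) = sh v (Q.west r c) ∧
    (r + c + 2 ≤ n → P.south (sh v r) (sh d c) = sh v (Q.south r c)) := by
  have hvd := D.sink.hvd
  apply box_ind
  intro r c hrc h1 h2
  constructor
  · have hW : ∀ c', c = c' + 1 → P.west (sh v r) (sh d c' + 1) = sh v (Q.west r c) := by
      rintro c' rfl
      have h3 := h1 c' rfl
      rw [west_succ, west_succ, ← D.rel' (by omega)]
      split_ifs
      · exact h3.1
      · exact h3.2 (by omega)
    have hcross : d ≤ c → P.west (sh v r) (d + 1) = P.west (sh v r) d := by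
      intro hdc
      apply west_cross
      rw [sh_lt (by omega)]
      exact D.sink.col r (by omega)
    by_cases hc : c = d
    · subst hc
      rw [sh_ge le_rfl, hcross le_rfl]
      rcases c with _ | c
      · rw [west_zero, west_zero]
      · have := hW c rfl
        rwa [sh_lt (by omega : c < c + 1)] at this
    · rcases c with _ | c
      · rw [sh_lt (by omega : 0 < d), west_zero, west_zero]
      · have := hW c rfl
        rcases sh_cases d c with ⟨h3, e3⟩ | ⟨h3, e3⟩
        · rw [e3] at this
          rw [sh_lt (by omega : c + 1 < d)]; exact this
        · rw [e3] at this
          rw [sh_ge (by omega : d ≤ c + 1)]; exact this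
  · intro hf
    have h3 := h2 hf
    have hN : P.north (sh v (r + 1)) (sh d c) = sh v (Q.north (r + 1) c) := by
      unfold north
      rw [← D.rel' (by omega)]
      split_ifs with hx
      · exact h3.2 (Q.inShape _ _ hx)
      · exact h3.1
    rw [south_eq Q r c hf, ← hN]
    by_cases hr : r + 1 = v
    · have hdc : c < d := by omega
      rw [sh_lt (by omega : r < v), sh_ge (by omega : v ≤ r + 1), sh_lt hdc,
        south_eq P r c (by omega), north_cross P, south_eq P (r + 1) c (by omega)]
      rw [hr]
      exact D.sink.row c (by omega)
    · have e1 : sh v (r + 1) = sh v r + 1 := by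
        rcases sh_cases v r with ⟨h3, e3⟩ | ⟨h3, e3⟩
        · rw [e3, sh_lt (by omega)]
        · rw [e3, sh_ge (by omega)]
      rw [e1]
      apply south_eq
      rcases sh_cases v r with ⟨h2, e2⟩ | ⟨h2, e2⟩ <;>
        rcases sh_cases d c with ⟨h3, e3⟩ | ⟨h3, e3⟩ <;> omega

theorem Del.north {n : ℕ} {P : PipeDream (n + 1)} {Q : PipeDream n} {v d : ℕ}
    (D : Del P Q v d) (r c : ℕ) (h : r + c + 1 ≤ n) :
    P.north (sh v r) (sh d c) = sh v (Q.north r c) := by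
  have h3 := D.pipes r c h
  unfold PipeDream.north
  rw [← D.rel' h]
  split_ifs with hx
  · exact h3.2 (Q.inShape _ _ hx)
  · exact h3.1

theorem Del.exit {n : ℕ} {P : PipeDream (n + 1)} {Q : PipeDream n} {v d : ℕ}
    (D : Del P Q v d) (c : ℕ) (h : c + 1 ≤ n) :
    P.exitPipe (sh d c) = sh v (Q.exitPipe c) := by
  have hvd := D.sink.hvd
  rw [exit_eq, exit_eq, ← D.north 0 c (by omega)]
  by_cases hv : v = 0
  · subst hv
    have hdc : c < d := by omega
    rw [sh_ge le_rfl, sh_lt hdc, north_cross P (D.sink.row c (by omega)),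
      south_eq P 0 c (by omega)]
  · rw [sh_lt (by omega : 0 < v)]

theorem SinkAt.classify {n : ℕ} {P : PipeDream (n + 1)} {v d : ℕ} (S : P.SinkAt v d) {r c : ℕ}
    (h : r + c + 1 ≤ n) : r = v ∨ c = d ∨ (r < v ∧ c < d ∧ r + c + 1 = n) ∨
    ∃ r' c', r' + c' + 2 ≤ n ∧ sh v r' = r ∧ sh d c' = c := by
  have hvd := S.hvd
  by_cases h1 : r = v
  · exact Or.inl h1
  by_cases h2 : c = d
  · exact Or.inr (Or.inl h2)
  right; right
  by_cases h3 : r < v ∧ c < d ∧ r + c + 1 = n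
  · exact Or.inl h3
  right
  obtain ⟨r', rfl⟩ := exists_sh h1
  obtain ⟨c', rfl⟩ := exists_sh h2
  refine ⟨r', c', ?_, rfl, rfl⟩
  rcases sh_cases v r' with ⟨h4, e4⟩ | ⟨h4, e4⟩ <;>
    rcases sh_cases d c' with ⟨h5, e5⟩ | ⟨h5, e5⟩ <;> omega

theorem sh_add {n v d r c : ℕ} (hvd : n ≤ v + d) (h : r + c + 2 ≤ n) :
    sh v r + sh d c + 2 ≤ n + 1 := by
  rcases sh_cases v r with ⟨h4, e4⟩ | ⟨h4, e4⟩ <;>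
    rcases sh_cases d c with ⟨h5, e5⟩ | ⟨h5, e5⟩ <;> omega

theorem Del.arc {n : ℕ} {P : PipeDream (n + 1)} {Q : PipeDream n} {v d : ℕ}
    (D : Del P Q v d) {i j : ℕ} : P.Arc (sh v i) (sh v j) ↔ Q.Arc i j := by
  have hvd := D.sink.hvd
  constructor
  · rintro ⟨r, c, h1, h2, h3, h4⟩
    rcases D.sink.classify (r := r) (c := c) (by omega) with h | h | ⟨h5, h6, h7⟩ | ⟨r', c', h5, h6, h7⟩
    · subst h
      rw [D.sink.row c (by omega)] at h2
      cases h2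
    · subst h
      rw [D.sink.col r (by omega)] at h2
      cases h2
    · rw [D.sink.south_diag h5 (by omega) h7] at h4
      exact absurd h4.symm (sh_ne _ _)
    · subst h6 h7
      have := D.pipes r' c' (by omega)
      rw [this.1] at h3
      rw [this.2 h5] at h4
      exact ⟨r', c', h5, by rw [D.rel r' c' h5, h2], sh_inj h3, sh_inj h4⟩
  · rintro ⟨r, c, h1, h2, rfl, rfl⟩
    have := D.pipes r c (by omega)
    exact ⟨sh v r, sh d c, sh_add hvd h1, by rw [← D.rel r c h1, h2], this.1, this.2 h1⟩

theorem Del.arc_sink {n : ℕ} {P : PipeDream (n + 1)} {Q : PipeDream n} {v d : ℕ}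
    (D : Del P Q v d) {i : ℕ} : P.Arc (sh v i) v ↔
      ∃ r c, r < v ∧ c < d ∧ r + c + 1 = n ∧ Q.west r c = i := by
  have hvd := D.sink.hvd
  constructor
  · rintro ⟨r, c, h1, h2, h3, h4⟩
    rcases D.sink.classify (r := r) (c := c) (by omega) with h | h | ⟨h5, h6, h7⟩ | ⟨r', c', h5, h6, h7⟩
    · subst h
      rw [D.sink.row c (by omega)] at h2
      cases h2
    · subst h
      rw [D.sink.col r (by omega)] at h2
      cases h2
    · have := (D.pipes r c (by omega)).1
      rw [sh_lt h5, sh_lt h6, h3] at this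
      exact ⟨r, c, h5, h6, h7, (sh_inj this).symm⟩
    · subst h6 h7
      have := D.pipes r' c' (by omega)
      rw [this.2 h5] at h4
      exact absurd h4 (sh_ne _ _)
  · rintro ⟨r, c, h1, h2, h3, rfl⟩
    have := (D.pipes r c (by omega)).1
    rw [sh_lt h1, sh_lt h2] at this
    exact ⟨r, c, by omega, D.sink.diag r c h1 h2 h3, this, D.sink.south_diag h1 h2.le h3⟩

theorem Del.not_arc {n : ℕ} {P : PipeDream (n + 1)} {Q : PipeDream n} {v d : ℕ}
    (D : Del P Q v d) {j : ℕ} : ¬ P.Arc v j := by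
  have hvd := D.sink.hvd
  rintro ⟨r, c, h1, h2, h3, h4⟩
  rcases D.sink.classify (r := r) (c := c) (by omega) with h | h | ⟨h5, h6, h7⟩ | ⟨r', c', h5, h6, h7⟩
  · subst h
    rw [D.sink.row c (by omega)] at h2
    cases h2
  · subst h
    rw [D.sink.col r (by omega)] at h2
    cases h2
  · have := (D.pipes r c (by omega)).1
    rw [sh_lt h5, sh_lt h6, h3] at this
    exact absurd this.symm (sh_ne _ _)
  · subst h6 h7
    have := D.pipes r' c' (by omega)
    rw [this.1] at h3
    exact absurd h3 (sh_ne _ _)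

theorem Del.reduced {n : ℕ} {P : PipeDream (n + 1)} {Q : PipeDream n} {v d : ℕ}
    (D : Del P Q v d) (hP : P.Reduced) : Q.Reduced := by
  intro r c r' c' hx hx' hne hor
  have hf := Q.inShape _ _ hx
  have hf' := Q.inShape _ _ hx'
  have h1 := D.pipes r c (by omega)
  have h2 := D.pipes r' c' (by omega)
  rw [D.rel _ _ hf] at hx
  rw [D.rel _ _ hf'] at hx'
  refine hP _ _ _ _ hx hx' ?_ ?_
  · intro h
    simp only [Prod.mk.injEq] at h
    exact hne (by rw [sh_inj h.1, sh_inj h.2])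
  · rw [h1.1, h1.2 hf, h2.1, h2.2 hf']
    rcases hor with ⟨h3, h4⟩ | ⟨h3, h4⟩
    · exact Or.inl ⟨by rw [h3], by rw [h4]⟩
    · exact Or.inr ⟨by rw [h3], by rw [h4]⟩

/-- Delete a row and a column. -/
def del {n : ℕ} (P : PipeDream (n + 1)) (v d : ℕ) : PipeDream n where
  cross r c := decide (r + c + 2 ≤ n) && P.cross (sh v r) (sh d c)
  inShape r c h := by simp at h; exact h.1

theorem SinkAt.del {n : ℕ} {P : PipeDream (n + 1)} {v d : ℕ} (S : P.SinkAt v d) :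
    Del P (P.del v d) v d where
  sink := S
  rel r c h := by simp [PipeDream.del, h]

/-- Insert a sink `v` exiting in column `d`. -/
def ins {n : ℕ} (Q : PipeDream n) (v d : ℕ) : PipeDream (n + 1) where
  cross r c := decide (r + c + 1 ≤ n) && (decide (r = v) || decide (c = d) ||
    Q.cross (if r < v then r else r - 1) (if c < d then c else c - 1))
  inShape r c h := by simp at h; omega

theorem del_ins {n : ℕ} (Q : PipeDream n) (v d : ℕ) (hv : v ≤ n) (hd : d ≤ n)
    (hvd : n ≤ v + d) : Del (Q.ins v d) Q v d where
  sink := {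
    hv := hv
    hd := hd
    hvd := hvd
    row := fun c h => by simp [ins]; omega
    col := fun r h => by simp [ins]; omega
    diag := fun r c h1 h2 h3 => by
      have : Q.cross r c = false := Q.elbow_of (by omega)
      simp [ins, h1, h2, this, h1.ne, h2.ne] }
  rel r c h := by
    have h1 := sh_add hvd h
    have e1 : (if sh v r < v then sh v r else sh v r - 1) = r := by
      rcases sh_cases v r with ⟨h4, e4⟩ | ⟨h4, e4⟩ <;> rw [e4]
      · simp [h4]
      · rw [if_neg (by omega)]; omega
    have e2 : (if sh d c < d then sh d c else sh d c - 1) = c := by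
      rcases sh_cases d c with ⟨h4, e4⟩ | ⟨h4, e4⟩ <;> rw [e4]
      · simp [h4]
      · rw [if_neg (by omega)]; omega
    have h2 : sh v r + sh d c + 1 ≤ n := by omega
    simp [ins, e1, e2, sh_ne]
    intro _; omega

end PipeDream

namespace PipeDream

theorem val_succAbove {n : ℕ} (v : Fin (n + 1)) (k : Fin n) :
    (v.succAbove k).val = sh v.val k.val := by
  unfold sh Fin.succAbove
  simp only [Fin.lt_def, Fin.val_castSucc]
  split_ifs <;> simp

theorem exists_delPerm {n : ℕ} (σ : Equiv.Perm (Fin (n + 1))) (q v : Fin (n + 1)) (h : σ q = v) :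
    ∃ τ : Equiv.Perm (Fin n), (∀ c, v.succAbove (τ c) = σ (q.succAbove c)) ∧
      (∀ k, q.succAbove (τ⁻¹ k) = σ⁻¹ (v.succAbove k)) := by
  have hsub : ∀ a, a ≠ q ↔ σ a ≠ v := by
    intro a
    rw [← h, σ.injective.ne_iff]
  let τ : Equiv.Perm (Fin n) := ((finSuccAboveEquiv q).trans
    (σ.subtypeEquiv hsub)).trans (finSuccAboveEquiv v).symm
  have key : ∀ c, v.succAbove (τ c) = σ (q.succAbove c) := by
    intro c
    have : (finSuccAboveEquiv v) (τ c) = σ.subtypeEquiv hsub (finSuccAboveEquiv q c) := by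
      simp [τ]
    have := congrArg Subtype.val this
    simpa [finSuccAboveEquiv_apply] using this
  refine ⟨τ, key, fun k => ?_⟩
  rw [Equiv.Perm.eq_inv_iff_eq, ← key]
  simp

theorem acyclic_of_linExt {n : ℕ} (P : PipeDream n) (π : Equiv.Perm (Fin n)) (h : P.LinExt π) :
    P.Acyclic := by
  have key : ∀ i j : ℕ, Relation.TransGen P.Arc i j →
      ∃ (hi : i < n) (hj : j < n), π⁻¹ ⟨i, hi⟩ < π⁻¹ ⟨j, hj⟩ := by
    intro i j hij
    induction hij with
    | single h1 =>
      exact ⟨(P.arc_lt h1).1, (P.arc_lt h1).2, h ⟨_, _⟩ ⟨_, _⟩ h1⟩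
    | tail _ h1 ih =>
      obtain ⟨a, b, h2⟩ := ih
      exact ⟨a, (P.arc_lt h1).2, h2.trans (h ⟨_, _⟩ ⟨_, _⟩ h1)⟩
  intro i hi
  obtain ⟨_, _, h3⟩ := key i i hi
  exact lt_irrefl _ h3

theorem delete_last {n : ℕ} (P : PipeDream (n + 1)) (ω σ : Equiv.Perm (Fin (n + 1)))
    (hR : P.Reduced) (hE : P.HasExitPerm ω) (hL : P.LinExt σ) :
    ∃ Q : PipeDream n, Del P Q (σ (Fin.last n)).val (ω⁻¹ (σ (Fin.last n))).val ∧ Q.Reduced ∧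
      (∀ ω' : Equiv.Perm (Fin n), (∀ c, (σ (Fin.last n)).succAbove (ω' c) =
        ω ((ω⁻¹ (σ (Fin.last n))).succAbove c)) → Q.HasExitPerm ω') ∧
      (∀ σ' : Equiv.Perm (Fin n), (∀ k, (Fin.last n).succAbove (σ'⁻¹ k) =
        σ⁻¹ ((σ (Fin.last n)).succAbove k)) → Q.LinExt σ') := by
  set v := σ (Fin.last n) with hv
  have hs : ∀ k, ¬ P.Arc v.val k := by
    intro k hk
    have h1 := hL v ⟨k, (P.arc_lt hk).2⟩ hk
    have h0 : σ⁻¹ v = Fin.last n := by simp [hv]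
    rw [h0] at h1
    exact absurd h1 (not_lt.mpr (Fin.le_last _))
  obtain ⟨d, S⟩ := P.exists_sinkAt hR v.val (by omega) hs
  have hd : d = (ω⁻¹ v).val := by
    have h1 := hE ⟨d, by have := S.hd; omega⟩
    have h2 := S.exit
    simp only at h1
    rw [h2] at h1
    rw [Fin.ext h1]
    simp
  subst hd
  have D := S.del
  refine ⟨_, D, D.reduced hR, ?_, ?_⟩
  · intro ω' hω' c
    have h1 := D.exit c.val (by omega)
    rw [← val_succAbove, hE, ← hω', val_succAbove] at h1
    exact (sh_inj h1).symm
  · intro σ' hσ' i j hij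
    rw [← D.arc, ← val_succAbove, ← val_succAbove] at hij
    have := hL _ _ hij
    rw [← hσ', ← hσ'] at this
    exact Fin.succAbove_lt_succAbove_iff.mp this

theorem exists_linExt : ∀ (n : ℕ) (ω π : Equiv.Perm (Fin n)), WeakLE π ω →
    ∃ P : PipeDream n, P.Reduced ∧ P.HasExitPerm ω ∧ P.LinExt π := by
  intro n
  induction n with
  | zero =>
    intro ω π _
    exact ⟨⟨fun _ _ => false, by simp⟩, by intro r c r' c' h; simp at h, fun c => c.elim0,
      fun i => i.elim0⟩
  | succ n ih =>
    intro ω π hW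
    obtain ⟨v, hv⟩ : ∃ v, v = π (Fin.last n) := ⟨_, rfl⟩
    obtain ⟨d, hd⟩ : ∃ d, d = ω⁻¹ v := ⟨_, rfl⟩
    have hd' : ω d = v := by simp [hd]
    obtain ⟨ω', hω1, hω2⟩ := exists_delPerm ω d v hd'
    obtain ⟨π', hπ1, hπ2⟩ := exists_delPerm π (Fin.last n) v hv.symm
    have hπv : π⁻¹ v = Fin.last n := by simp [hv]
    have hgt : ∀ y, v < y → ω⁻¹ y < d := by
      intro y hy
      rw [hd]
      apply hW v y hy
      rw [hπv]
      refine lt_of_le_of_ne (Fin.le_last _) ?_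
      intro h
      rw [← hπv] at h
      exact hy.ne' (π⁻¹.injective h)
    have hvd : n ≤ v.val + d.val := by
      have h1 : (Finset.Ioi v).card ≤ (Finset.Iio d).card := by
        apply Finset.card_le_card_of_injOn (fun y => ω⁻¹ y)
        · intro y hy
          simpa using hgt y (by simpa using hy)
        · exact ω⁻¹.injective.injOn
      rw [Fin.card_Ioi, Fin.card_Iio] at h1
      omega
    have hW' : WeakLE π' ω' := by
      intro i j hij h
      rw [← Fin.succAbove_lt_succAbove_iff (p := Fin.last n), hπ2, hπ2] at h
      rw [← Fin.succAbove_lt_succAbove_iff (p := d), hω2, hω2]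
      exact hW _ _ (Fin.succAbove_lt_succAbove_iff.mpr hij) h
    obtain ⟨Q, hR, hE, hL⟩ := ih ω' π' hW'
    have D := Q.del_ins v.val d.val (by omega) (by omega) hvd
    have S := D.sink
    refine ⟨Q.ins v.val d.val, ?_, ?_, ?_⟩
    · set P := Q.ins v.val d.val with hP
      have cl : ∀ r c, P.cross r c = true →
          (r = v.val ∧ v.val + c + 1 ≤ n ∧ P.west r c = v.val ∧
            ∃ y, v.val ≤ y ∧ P.south r c = sh v.val y) ∨
          (c = d.val ∧ r + d.val + 1 ≤ n ∧ P.south r c = v.val ∧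
            ∃ y, P.west r c = sh v.val y ∧ ∀ e : Fin n, (ω' e).val = y → d.val ≤ e.val) ∨
          (∃ r' c', r' + c' + 2 ≤ n ∧ r = sh v.val r' ∧ c = sh d.val c' ∧
            Q.cross r' c' = true ∧ P.west r c = sh v.val (Q.west r' c') ∧
            P.south r c = sh v.val (Q.south r' c')) := by
        intro r c hx
        have hf := P.inShape _ _ hx
        rcases S.classify (r := r) (c := c) (by omega) with h | h | ⟨h1, h2, h3⟩ |
          ⟨r', c', h1, rfl, rfl⟩
        · left
          subst h
          refine ⟨rfl, by omega, P.row_path _ S.row c (by omega), Q.north v.val c, ?_, ?_⟩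
          · have hb := Q.bounds v.val c (by omega)
            unfold PipeDream.north
            split_ifs with hx
            · have := hb.2 (Q.inShape _ _ hx); omega
            · exact hb.1.1
          · rw [south_eq P _ c (by omega), ← D.north v.val c (by omega), sh_ge le_rfl,
              sh_lt (by omega)]
        · right; left
          subst h
          refine ⟨rfl, by omega, S.south_col r (by omega), Q.west r d.val, ?_, ?_⟩
          · rw [← (D.pipes r d.val (by omega)).1, sh_ge (le_refl d.val), sh_lt (by omega),
              west_cross P hx]
          · intro e he
            obtain ⟨c', h1, h2, h3⟩ := (Q.exits r d.val (by omega)).1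
            have h4 := hE ⟨c', h2⟩
            simp only at h4
            rw [h3, ← he] at h4
            have := ω'.injective (Fin.ext h4)
            rw [this]; exact h1
        · rw [S.diag r c h1 h2 h3] at hx
          cases hx
        · right; right
          have := D.pipes r' c' (by omega)
          exact ⟨r', c', h1, rfl, rfl, by rw [D.rel _ _ h1]; exact hx, this.1, this.2 h1⟩
      have hBC : ∀ y, v.val ≤ y → (∀ e : Fin n, (ω' e).val = y → d.val ≤ e.val) → y < n →
          False := by
        intro y h1 h2 h3
        have h4 := h2 (ω'⁻¹ ⟨y, h3⟩) (by simp)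
        have h5 := hgt (v.succAbove ⟨y, h3⟩) (by
          rw [Fin.lt_def, val_succAbove, sh_ge h1]; simp; omega)
        rw [← hω2, Fin.lt_def, val_succAbove, sh_ge h4] at h5
        omega
      intro r c r' c' hx hx' hne hor
      have hf := P.inShape _ _ hx
      have hf' := P.inShape _ _ hx'
      have b := P.bounds r c (by omega)
      have b' := P.bounds r' c' (by omega)
      have bs := (b.2 hf).2
      have bs' := (b'.2 hf').2
      have e1 := fun y => sh_ne v.val y
      rcases cl r c hx with ⟨a1, a2, a3, y, a4, a5⟩ | ⟨a1, a2, a3, y, a4, a5⟩ |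
          ⟨s, t, a1, a2, a3, a4, a5, a6⟩ <;>
        rcases cl r' c' hx' with ⟨b1, b2, b3, z, b4, b5⟩ | ⟨b1, b2, b3, z, b4, b5⟩ |
          ⟨s', t', b1, b2, b3, b4, b5, b6⟩
      · subst a1
        subst b1
        have : P.south v.val c = P.south v.val c' := by
          rcases hor with h | h
          · exact h.2
          · rw [h.2, b3, ← h.1, a3]
        rw [south_eq P _ _ (by omega), south_eq P _ _ (by omega)] at this
        exact hne (by rw [P.north_inj _ (by omega) (by omega) this])
      · rcases hor with h | h
        · rw [a3, b4] at h
          exact e1 _ h.1.symm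
        · rw [a5, b4] at h
          have := sh_inj h.2
          subst this
          rw [a5, sh_ge a4] at bs
          exact hBC y a4 b5 (by omega)
      · rcases hor with h | h
        · rw [a3, b5] at h; exact e1 _ h.1.symm
        · rw [a3, b6] at h; exact e1 _ h.1.symm
      · rcases hor with h | h
        · rw [a3, b5] at h
          exact e1 _ h.2.symm
        · rw [a4, b5] at h
          have := sh_inj h.1
          subst this
          rw [b5, sh_ge b4] at bs'
          exact hBC y b4 a5 (by omega)
      · subst a1
        subst b1
        have : P.west r d.val = P.west r' d.val := by
          rcases hor with h | h
          · exact h.1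
          · rw [h.1, b3, ← h.2, a3]
        exact hne (by rw [P.west_inj _ (by omega) (by omega) this])
      · rcases hor with h | h
        · rw [a3, b6] at h; exact e1 _ h.2.symm
        · rw [a3, b5] at h; exact e1 _ h.2.symm
      · rcases hor with h | h
        · rw [b3, a5] at h; exact e1 _ h.1
        · rw [b3, a6] at h; exact e1 _ h.2
      · rcases hor with h | h
        · rw [b3, a6] at h; exact e1 _ h.2
        · rw [b3, a5] at h; exact e1 _ h.1
      · refine hR s t s' t' a4 b4 ?_ ?_
        · intro h
          simp only [Prod.mk.injEq] at h
          exact hne (by rw [a2, a3, b2, b3, h.1, h.2])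
        · rw [a5, a6, b5, b6] at hor
          rcases hor with h | h
          · exact Or.inl ⟨sh_inj h.1, sh_inj h.2⟩
          · exact Or.inr ⟨sh_inj h.1, sh_inj h.2⟩
    · intro c
      by_cases hc : c = d
      · rw [hc, hd', S.exit]
      · obtain ⟨c', rfl⟩ := Fin.exists_succAbove_eq hc
        rw [val_succAbove, D.exit c'.val (by omega), hE, ← hω1, val_succAbove]
    · intro i j hij
      have hi : i ≠ v := by
        rintro rfl
        exact D.not_arc hij
      by_cases hj : j = v
      · rw [hj, hπv]
        refine lt_of_le_of_ne (Fin.le_last _) ?_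
        intro h
        rw [← hπv] at h
        exact hi (π⁻¹.injective h)
      · obtain ⟨i', rfl⟩ := Fin.exists_succAbove_eq hi
        obtain ⟨j', rfl⟩ := Fin.exists_succAbove_eq hj
        rw [val_succAbove, val_succAbove, D.arc] at hij
        rw [← hπ2, ← hπ2]
        exact Fin.succAbove_lt_succAbove_iff.mpr (hL _ _ hij)

theorem SinkAt.west_iff {n : ℕ} {P : PipeDream (n + 1)} {v d : ℕ} (S : P.SinkAt v d)
    {r c : ℕ} (h : r + c = n) : P.west r c = v ↔ r ≤ v ∧ c ≤ d := by
  constructor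
  · intro hw
    refine ⟨hw ▸ (P.bounds r c (by omega)).1.1, ?_⟩
    obtain ⟨c', h1, h2, h3⟩ := (P.exits r c (by omega)).1
    rw [hw, ← S.exit] at h3
    have := S.hd
    have := P.north_inj 0 (by omega) (by omega) h3
    omega
  · rintro ⟨h1, h2⟩
    exact S.west_diag h1 h2 h

/-- The number of entries before position `p` satisfying the two conditions of the rule. -/
def cntA {n : ℕ} (ω σ : Equiv.Perm (Fin n)) (p : ℕ) (j : Fin n) : ℕ :=
  (Finset.univ.filter (fun q : Fin n => q.val < p ∧ ω⁻¹ (σ q) < ω⁻¹ j)).card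

def cntB {n : ℕ} (σ : Equiv.Perm (Fin n)) (p : ℕ) (i : Fin n) : ℕ :=
  (Finset.univ.filter (fun q : Fin n => q.val < p ∧ i < σ q)).card

theorem contact_base {m : ℕ} (P : PipeDream (m + 2)) (ω σ : Equiv.Perm (Fin (m + 2)))
    (hR : P.Reduced) (hE : P.HasExitPerm ω) (hL : P.LinExt σ) (i j : Fin (m + 2))
    (hij : i < j) (hω : ω⁻¹ j < ω⁻¹ i)
    (hσ : (σ ⟨m, by omega⟩ = i ∧ σ ⟨m + 1, by omega⟩ = j) ∨
      (σ ⟨m, by omega⟩ = j ∧ σ ⟨m + 1, by omega⟩ = i)) :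
    (P.Arc i.val j.val ∨ P.Arc j.val i.val) ↔ ¬ (cntA ω σ m j ≤ cntB σ m i) := by
  have hA : cntA ω σ m j = (ω⁻¹ j).val := by
    rw [← Fin.card_Iio]
    unfold cntA
    apply Finset.card_equiv (σ.trans ω⁻¹)
    intro q
    simp only [Finset.mem_filter, Finset.mem_univ, true_and, Equiv.trans_apply, Finset.mem_Iio]
    refine ⟨fun h => h.2, fun h => ⟨?_, h⟩⟩
    by_contra hq
    have : q = ⟨m, by omega⟩ ∨ q = ⟨m + 1, by omega⟩ := by
      rcases q with ⟨q, hq'⟩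
      simp only [Fin.mk.injEq] at hq ⊢
      omega
    have hq2 : σ q = i ∨ σ q = j := by
      rcases this with h1 | h1 <;> rw [h1] <;> tauto
    rcases hq2 with h1 | h1 <;> rw [h1] at h
    · exact absurd h (not_lt.mpr hω.le)
    · exact lt_irrefl _ h
  have hB : cntB σ m i = m - i.val := by
    have hc : ((Finset.Ioi i).erase j).card = m - i.val := by
      rw [Finset.card_erase_of_mem (by simpa using hij), Fin.card_Ioi]
      omega
    rw [← hc]
    unfold cntB
    apply Finset.card_equiv σ
    intro q
    simp only [Finset.mem_filter, Finset.mem_univ, true_and, Finset.mem_Ioi, Finset.mem_erase]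
    constructor
    · rintro ⟨h1, h2⟩
      refine ⟨?_, h2⟩
      intro h3
      have : q = ⟨m, by omega⟩ ∨ q = ⟨m + 1, by omega⟩ := by
        rcases hσ with h | h
        · right; apply σ.injective; rw [h3, h.2]
        · left; apply σ.injective; rw [h3, h.1]
      rcases this with h4 | h4 <;> (rw [h4] at h1; simp at h1)
    · rintro ⟨h1, h2⟩
      refine ⟨?_, h2⟩
      by_contra hq
      have : q = ⟨m, by omega⟩ ∨ q = ⟨m + 1, by omega⟩ := by
        rcases q with ⟨q, hq'⟩
        simp only [Fin.mk.injEq] at hq ⊢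
        omega
      have hq2 : σ q = i ∨ σ q = j := by
        rcases this with h1 | h1 <;> rw [h1] <;> tauto
      rcases hq2 with h3 | h3
      · rw [h3] at h2; exact lt_irrefl _ h2
      · exact h1 h3
  rw [hA, hB]
  obtain ⟨Q, D, hR', hE', hL'⟩ := P.delete_last ω σ hR hE hL
  obtain ⟨ω', hω1, hω2⟩ := exists_delPerm ω (ω⁻¹ (σ (Fin.last (m + 1)))) (σ (Fin.last (m + 1)))
    (by simp)
  obtain ⟨σ', hσ1, hσ2⟩ := exists_delPerm σ (Fin.last (m + 1)) _ rfl
  obtain ⟨Q2, D2, -⟩ := Q.delete_last ω' σ' hR' (hE' ω' hω1) (hL' σ' hσ2)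
  have hlast : Fin.last (m + 1) = ⟨m + 1, by omega⟩ := rfl
  obtain ⟨x, hx⟩ : ∃ x, x = σ' (Fin.last m) := ⟨_, rfl⟩
  have hx1 := hσ1 (Fin.last m)
  have hx2 := hω2 x
  rw [← hx] at D2 hx1
  rw [Fin.succAbove_last_apply, show (Fin.last m).castSucc = (⟨m, by omega⟩ : Fin (m + 2)) from rfl]
    at hx1
  rw [hx1] at hx2
  obtain ⟨e, he⟩ : ∃ e, e = ω'⁻¹ x := ⟨_, rfl⟩
  rw [← he] at D2 hx2
  have v1 := val_succAbove (σ (Fin.last (m + 1))) x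
  have v2 := val_succAbove (ω⁻¹ (σ (Fin.last (m + 1)))) e
  rw [hx1] at v1
  rw [hx2] at v2
  rw [hlast] at v1 v2 D
  have hil := i.isLt
  have hjl := j.isLt
  have hcl := (ω⁻¹ i).isLt
  rw [Fin.lt_def] at hij hω
  rcases hσ with ⟨h1, h2⟩ | ⟨h1, h2⟩
  · rw [h1, h2] at v1 v2
    rw [h2] at D
    rw [or_iff_left D.not_arc, v1, D.arc_sink]
    rcases sh_cases j.val x.val with ⟨h3, h4⟩ | ⟨h3, h4⟩ <;>
      rcases sh_cases (ω⁻¹ j).val e.val with ⟨h5, h6⟩ | ⟨h5, h6⟩ <;> try omega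
    constructor
    · rintro ⟨r, c, k1, k2, k3, k4⟩
      have := (D2.sink.west_iff (by omega)).mp k4
      omega
    · intro h
      exact ⟨i.val, m - i.val, by omega, by omega, by omega,
        (D2.sink.west_iff (by omega)).mpr ⟨by omega, by omega⟩⟩
  · rw [h1, h2] at v1 v2
    rw [h2] at D
    rw [or_iff_right D.not_arc, v1, D.arc_sink]
    rcases sh_cases i.val x.val with ⟨h3, h4⟩ | ⟨h3, h4⟩ <;>
      rcases sh_cases (ω⁻¹ i).val e.val with ⟨h5, h6⟩ | ⟨h5, h6⟩ <;> try omega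
    constructor
    · rintro ⟨r, c, k1, k2, k3, k4⟩
      have := (D2.sink.west_iff (by omega)).mp k4
      omega
    · intro h
      exact ⟨m - (ω⁻¹ j).val, (ω⁻¹ j).val, by omega, by omega, by omega,
        (D2.sink.west_iff (by omega)).mpr ⟨by omega, by omega⟩⟩

theorem contact_iff : ∀ (n : ℕ) (P : PipeDream n) (ω σ : Equiv.Perm (Fin n))
    (_ : P.Reduced) (_ : P.HasExitPerm ω) (_ : P.LinExt σ) (i j : Fin n)
    (_ : i < j) (_ : ω⁻¹ j < ω⁻¹ i) (p : ℕ) (hp : p + 1 < n)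
    (_ : (σ ⟨p, by omega⟩ = i ∧ σ ⟨p + 1, hp⟩ = j) ∨ (σ ⟨p, by omega⟩ = j ∧ σ ⟨p + 1, hp⟩ = i)),
    (P.Arc i.val j.val ∨ P.Arc j.val i.val) ↔ ¬ (cntA ω σ p j ≤ cntB σ p i) := by
  intro n
  induction n with
  | zero => intro P ω σ _ _ _ i; exact i.elim0
  | succ n ih =>
    intro P ω σ hR hE hL i j hij hω p hp hσ
    by_cases hpn : p + 1 = n
    · subst hpn
      exact contact_base P ω σ hR hE hL i j hij hω hσ
    obtain ⟨Q, D, hR', hE', hL'⟩ := P.delete_last ω σ hR hE hL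
    obtain ⟨ω', hω1, hω2⟩ := exists_delPerm ω (ω⁻¹ (σ (Fin.last n))) (σ (Fin.last n)) (by simp)
    obtain ⟨σ', hσ1, hσ2⟩ := exists_delPerm σ (Fin.last n) _ rfl
    have hne : ∀ q (hq : q < n), σ ⟨q, by omega⟩ ≠ σ (Fin.last n) := by
      intro q hq h
      have := congrArg Fin.val (σ.injective h)
      simp at this
      omega
    have hi : i ≠ σ (Fin.last n) := by
      rcases hσ with h | h
      · rw [← h.1]; exact hne p (by omega)
      · rw [← h.2]; exact hne (p + 1) (by omega)
    have hj : j ≠ σ (Fin.last n) := by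
      rcases hσ with h | h
      · rw [← h.2]; exact hne (p + 1) (by omega)
      · rw [← h.1]; exact hne p (by omega)
    obtain ⟨i', rfl⟩ := Fin.exists_succAbove_eq hi
    obtain ⟨j', rfl⟩ := Fin.exists_succAbove_eq hj
    have hσ3 : ∀ q (hq : q < n), σ ⟨q, by omega⟩ =
        (σ (Fin.last n)).succAbove (σ' ⟨q, hq⟩) := by
      intro q hq
      rw [hσ1, Fin.succAbove_last_apply]
      rfl
    rw [hσ3 p (by omega), hσ3 (p + 1) (by omega)] at hσ
    simp only [Fin.succAbove_right_inj] at hσ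
    rw [← hω2, ← hω2, Fin.succAbove_lt_succAbove_iff] at hω
    rw [Fin.succAbove_lt_succAbove_iff] at hij
    have key := ih Q ω' σ' hR' (hE' ω' hω1) (hL' σ' hσ2) i' j' hij hω p (by omega) hσ
    have cA : cntA ω σ p ((σ (Fin.last n)).succAbove j') = cntA ω' σ' p j' := by
      unfold cntA
      rw [Finset.card_filter, Finset.card_filter, Fin.sum_univ_castSucc]
      rw [if_neg (by simp; omega), add_zero]
      apply Finset.sum_congr rfl
      intro q _
      have := hσ1 q
      rw [Fin.succAbove_last_apply] at this
      simp only [← this, ← hω2, Fin.succAbove_lt_succAbove_iff, Fin.val_castSucc]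
    have cB : cntB σ p ((σ (Fin.last n)).succAbove i') = cntB σ' p i' := by
      unfold cntB
      rw [Finset.card_filter, Finset.card_filter, Fin.sum_univ_castSucc]
      rw [if_neg (by simp; omega), add_zero]
      apply Finset.sum_congr rfl
      intro q _
      have := hσ1 q
      rw [Fin.succAbove_last_apply] at this
      simp only [← this, Fin.succAbove_lt_succAbove_iff, Fin.val_castSucc]
    rw [cA, cB, ← key, val_succAbove, val_succAbove, D.arc, D.arc]

end PipeDream

namespace PipeDream

theorem swap_lt {n p : ℕ} (hp : p + 1 < n) (u v : Fin n)
    (h : ¬ (u = ⟨p, Nat.lt_of_succ_lt hp⟩ ∧ v = ⟨p + 1, hp⟩))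
    (h' : ¬ (u = ⟨p + 1, hp⟩ ∧ v = ⟨p, Nat.lt_of_succ_lt hp⟩)) :
    Equiv.swap ⟨p, Nat.lt_of_succ_lt hp⟩ ⟨p + 1, hp⟩ u <
      Equiv.swap ⟨p, Nat.lt_of_succ_lt hp⟩ ⟨p + 1, hp⟩ v ↔ u < v := by
  simp only [Equiv.swap_apply_def, Fin.ext_iff] at *
  simp only [Fin.lt_def]
  split_ifs <;> simp_all <;> omega

/-- Exchange of the entries at positions `p` and `p + 1`. -/
def sw {n : ℕ} (a : Equiv.Perm (Fin n)) (p : ℕ) (hp : p + 1 < n) : Equiv.Perm (Fin n) :=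
  a * Equiv.swap ⟨p, Nat.lt_of_succ_lt hp⟩ ⟨p + 1, hp⟩

theorem sw_inv {n : ℕ} (a : Equiv.Perm (Fin n)) (p : ℕ) (hp : p + 1 < n) (k : Fin n) :
    (sw a p hp)⁻¹ k = Equiv.swap ⟨p, Nat.lt_of_succ_lt hp⟩ ⟨p + 1, hp⟩ (a⁻¹ k) := by
  simp [sw, mul_inv_rev]

theorem sw_sw {n : ℕ} (a : Equiv.Perm (Fin n)) (p : ℕ) (hp : p + 1 < n) :
    sw (sw a p hp) p hp = a := by
  simp [sw, mul_assoc]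

theorem sw_left {n : ℕ} (a : Equiv.Perm (Fin n)) (p : ℕ) (hp : p + 1 < n) :
    sw a p hp ⟨p, Nat.lt_of_succ_lt hp⟩ = a ⟨p + 1, hp⟩ := by
  simp [sw]

theorem sw_right {n : ℕ} (a : Equiv.Perm (Fin n)) (p : ℕ) (hp : p + 1 < n) :
    sw a p hp ⟨p + 1, hp⟩ = a ⟨p, Nat.lt_of_succ_lt hp⟩ := by
  simp [sw]

theorem sw_of_lt {n : ℕ} (a : Equiv.Perm (Fin n)) (p : ℕ) (hp : p + 1 < n) (q : Fin n)
    (hq : q.val < p) : sw a p hp q = a q := by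
  unfold sw
  rw [Equiv.Perm.mul_apply, Equiv.swap_apply_of_ne_of_ne]
  · intro h; rw [h] at hq; simp at hq
  · intro h; rw [h] at hq; simp at hq

theorem sw_lt {n : ℕ} (a : Equiv.Perm (Fin n)) (p : ℕ) (hp : p + 1 < n) (k l : Fin n)
    (h : ¬ (k = a ⟨p, Nat.lt_of_succ_lt hp⟩ ∧ l = a ⟨p + 1, hp⟩))
    (h' : ¬ (k = a ⟨p + 1, hp⟩ ∧ l = a ⟨p, Nat.lt_of_succ_lt hp⟩)) :
    (sw a p hp)⁻¹ k < (sw a p hp)⁻¹ l ↔ a⁻¹ k < a⁻¹ l := by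
  rw [sw_inv, sw_inv]
  apply swap_lt
  · rwa [Equiv.Perm.inv_eq_iff_eq, Equiv.Perm.inv_eq_iff_eq]
  · rwa [Equiv.Perm.inv_eq_iff_eq, Equiv.Perm.inv_eq_iff_eq]

theorem inv_adj {n : ℕ} (a : Equiv.Perm (Fin n)) (p : ℕ) (hp : p + 1 < n) :
    a⁻¹ (a ⟨p, Nat.lt_of_succ_lt hp⟩) < a⁻¹ (a ⟨p + 1, hp⟩) := by
  simp

theorem sw_inv_adj {n : ℕ} (a : Equiv.Perm (Fin n)) (p : ℕ) (hp : p + 1 < n) :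
    (sw a p hp)⁻¹ (a ⟨p + 1, hp⟩) < (sw a p hp)⁻¹ (a ⟨p, Nat.lt_of_succ_lt hp⟩) := by
  simp [sw_inv]

theorem cntA_sw {n : ℕ} (ω a : Equiv.Perm (Fin n)) (p : ℕ) (hp : p + 1 < n) (j : Fin n) :
    cntA ω (sw a p hp) p j = cntA ω a p j := by
  unfold cntA
  congr 1
  apply Finset.filter_congr
  intro q _
  constructor <;> rintro ⟨h1, h2⟩ <;> refine ⟨h1, ?_⟩ <;> simpa [sw_of_lt _ _ _ _ h1] using h2

theorem cntB_sw {n : ℕ} (a : Equiv.Perm (Fin n)) (p : ℕ) (hp : p + 1 < n) (i : Fin n) :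
    cntB (sw a p hp) p i = cntB a p i := by
  unfold cntB
  congr 1
  apply Finset.filter_congr
  intro q _
  constructor <;> rintro ⟨h1, h2⟩ <;> refine ⟨h1, ?_⟩ <;> simpa [sw_of_lt _ _ _ _ h1] using h2

theorem linExt_sw {n : ℕ} (P : PipeDream n) (a : Equiv.Perm (Fin n)) (p : ℕ) (hp : p + 1 < n)
    (hL : P.LinExt a)
    (h : ¬ P.Arc (a ⟨p, Nat.lt_of_succ_lt hp⟩).val (a ⟨p + 1, hp⟩).val) :
    P.LinExt (sw a p hp) := by
  intro i j hij
  have h1 := hL i j hij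
  refine (sw_lt a p hp i j ?_ ?_).mpr h1
  · rintro ⟨rfl, rfl⟩; exact h hij
  · rintro ⟨rfl, rfl⟩; exact absurd h1 (not_lt.mpr (inv_adj a p hp).le)

theorem rewStep_iff {n : ℕ} (ω a b : Equiv.Perm (Fin n)) :
    RewStep ω a b ↔ ∃ (p : ℕ) (hp : p + 1 < n),
      a ⟨p, Nat.lt_of_succ_lt hp⟩ < a ⟨p + 1, hp⟩ ∧ b = sw a p hp ∧
      cntA ω a p (a ⟨p + 1, hp⟩) ≤ cntB a p (a ⟨p, Nat.lt_of_succ_lt hp⟩) := by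
  constructor
  · rintro ⟨p, hp, i, j, h1, rfl, rfl, h2, h3⟩
    exact ⟨p, hp, h1, h2, h3⟩
  · rintro ⟨p, hp, h1, h2, h3⟩
    exact ⟨p, hp, _, _, h1, rfl, rfl, h2, h3⟩

/-- Steps preserve the linear extensions. -/
theorem linExt_step {n : ℕ} (P : PipeDream n) (ω a b : Equiv.Perm (Fin n))
    (hR : P.Reduced) (hE : P.HasExitPerm ω) (hL : P.LinExt a)
    (ha : WeakLE a ω) (hb : WeakLE b ω) (h : RewStep ω a b ∨ RewStep ω b a) : P.LinExt b := by
  rcases h with h | h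
  · obtain ⟨p, hp, h1, rfl, h3⟩ := (rewStep_iff ω a b).mp h
    have hω := hb _ _ h1 (sw_inv_adj a p hp)
    have hc := contact_iff n P ω a hR hE hL _ _ h1 hω p hp (Or.inl ⟨rfl, rfl⟩)
    apply linExt_sw P a p hp hL
    intro hA
    exact hc.mp (Or.inl hA) h3
  · obtain ⟨p, hp, h1, rfl, h3⟩ := (rewStep_iff ω b a).mp h
    have hω := ha _ _ h1 (sw_inv_adj b p hp)
    have hc := contact_iff n P ω _ hR hE hL _ _ h1 hω p hp
      (Or.inr ⟨sw_left b p hp, sw_right b p hp⟩)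
    rw [cntA_sw, cntB_sw] at hc
    rw [← sw_sw b p hp]
    apply linExt_sw P _ p hp hL
    rw [sw_left, sw_right]
    intro hA
    exact hc.mp (Or.inr hA) h3

/-- An adjacent exchange between two linear extensions is a step. -/
theorem step_of_linExt {n : ℕ} (P : PipeDream n) (ω a : Equiv.Perm (Fin n))
    (hR : P.Reduced) (hE : P.HasExitPerm ω) (hL : P.LinExt a) (p : ℕ) (hp : p + 1 < n)
    (ha : WeakLE a ω) (hb : WeakLE (sw a p hp) ω) (hL' : P.LinExt (sw a p hp)) :
    RewStep ω a (sw a p hp) ∨ RewStep ω (sw a p hp) a := by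
  have hne : a ⟨p, Nat.lt_of_succ_lt hp⟩ ≠ a ⟨p + 1, hp⟩ := by
    intro h
    have := a.injective h
    simp at this
  have n1 : ¬ P.Arc (a ⟨p, Nat.lt_of_succ_lt hp⟩).val (a ⟨p + 1, hp⟩).val := by
    intro h
    exact absurd (hL' _ _ h) (not_lt.mpr (sw_inv_adj a p hp).le)
  have n2 : ¬ P.Arc (a ⟨p + 1, hp⟩).val (a ⟨p, Nat.lt_of_succ_lt hp⟩).val := by
    intro h
    exact absurd (hL _ _ h) (not_lt.mpr (inv_adj a p hp).le)
  rcases lt_or_gt_of_ne hne with h1 | h1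
  · left
    have hω := hb _ _ h1 (sw_inv_adj a p hp)
    have hc := contact_iff n P ω a hR hE hL _ _ h1 hω p hp (Or.inl ⟨rfl, rfl⟩)
    refine (rewStep_iff _ _ _).mpr ⟨p, hp, h1, rfl, ?_⟩
    by_contra h
    rcases hc.mpr h with h | h
    · exact n1 h
    · exact n2 h
  · right
    have hω := ha _ _ h1 (inv_adj a p hp)
    have hc := contact_iff n P ω a hR hE hL _ _ h1 hω p hp (Or.inr ⟨rfl, rfl⟩)
    refine (rewStep_iff _ _ _).mpr ⟨p, hp, ?_, (sw_sw a p hp).symm, ?_⟩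
    · rw [sw_left, sw_right]; exact h1
    · rw [sw_left, sw_right, cntA_sw, cntB_sw]
      by_contra h
      rcases hc.mpr h with h | h
      · exact n2 h
      · exact n1 h

/-- The pairs ordered differently by two permutations. -/
def dis {n : ℕ} (a b : Equiv.Perm (Fin n)) : Finset (Fin n × Fin n) :=
  Finset.univ.filter (fun x => a⁻¹ x.1 < a⁻¹ x.2 ∧ b⁻¹ x.2 < b⁻¹ x.1)

theorem exists_descent {n : ℕ} (a b : Equiv.Perm (Fin n)) (h : a ≠ b) :
    ∃ (p : ℕ) (hp : p + 1 < n),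
      b⁻¹ (a ⟨p + 1, hp⟩) < b⁻¹ (a ⟨p, Nat.lt_of_succ_lt hp⟩) := by
  by_contra hcon
  push Not at hcon
  apply h
  cases n with
  | zero => exact Subsingleton.elim _ _
  | succ n =>
    have hmono : StrictMono (fun x => b⁻¹ (a x)) := by
      rw [Fin.strictMono_iff_lt_succ]
      intro i
      refine lt_of_le_of_ne (hcon i.val (by omega)) ?_
      intro h1
      have := a.injective (b⁻¹.injective h1)
      have := congrArg Fin.val this
      simp at this
    have h2 : (fun x => b⁻¹ (a x)) = id := by
      apply hmono.range_inj strictMono_id |>.mp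
      rw [Set.range_id]
      exact (a.trans b⁻¹).surjective.range_eq
    ext x
    have := congrFun h2 x
    simp only [id] at this
    rw [Equiv.Perm.inv_eq_iff_eq] at this
    rw [this]

theorem chain {n : ℕ} (P : PipeDream n) (ω b : Equiv.Perm (Fin n))
    (hR : P.Reduced) (hE : P.HasExitPerm ω) (hLb : P.LinExt b) (hb : WeakLE b ω) :
    ∀ (m : ℕ) (a : Equiv.Perm (Fin n)), (dis a b).card ≤ m → P.LinExt a → WeakLE a ω →
      Relation.ReflTransGen
        (fun a b => WeakLE a ω ∧ WeakLE b ω ∧ (RewStep ω a b ∨ RewStep ω b a)) a b := by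
  intro m
  induction m with
  | zero =>
    intro a hm _ _
    by_cases hab : a = b
    · subst hab; exact Relation.ReflTransGen.refl
    · obtain ⟨p, hp, h⟩ := exists_descent a b hab
      have h1 : (a ⟨p, Nat.lt_of_succ_lt hp⟩, a ⟨p + 1, hp⟩) ∈ dis a b := by
        simp only [dis, Finset.mem_filter, Finset.mem_univ, true_and]
        exact ⟨inv_adj a p hp, h⟩
      have := Finset.card_pos.mpr ⟨_, h1⟩
      omega
  | succ m ih =>
    intro a hm hL ha
    by_cases hab : a = b
    · subst hab; exact Relation.ReflTransGen.refl
    · obtain ⟨p, hp, h⟩ := exists_descent a b hab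
      have h1 : (a ⟨p, Nat.lt_of_succ_lt hp⟩, a ⟨p + 1, hp⟩) ∈ dis a b := by
        simp only [dis, Finset.mem_filter, Finset.mem_univ, true_and]
        exact ⟨inv_adj a p hp, h⟩
      have hL' : P.LinExt (sw a p hp) := by
        apply linExt_sw P a p hp hL
        intro hA
        exact absurd (hLb _ _ hA) (not_lt.mpr h.le)
      have ha' : WeakLE (sw a p hp) ω := by
        intro i j hij hlt
        by_cases c1 : j = a ⟨p, Nat.lt_of_succ_lt hp⟩ ∧ i = a ⟨p + 1, hp⟩
        · rw [c1.1, c1.2] at hlt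
          exact absurd hlt (not_lt.mpr (sw_inv_adj a p hp).le)
        by_cases c2 : j = a ⟨p + 1, hp⟩ ∧ i = a ⟨p, Nat.lt_of_succ_lt hp⟩
        · apply hb i j hij
          rw [c2.1, c2.2]; exact h
        exact ha i j hij ((sw_lt a p hp j i c1 c2).mp hlt)
      have hsub : dis (sw a p hp) b ⊆
          (dis a b).erase (a ⟨p, Nat.lt_of_succ_lt hp⟩, a ⟨p + 1, hp⟩) := by
        rintro ⟨k, l⟩ hkl
        simp only [dis, Finset.mem_filter, Finset.mem_univ, true_and, Finset.mem_erase] at hkl ⊢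
        have c1 : ¬ (k = a ⟨p, Nat.lt_of_succ_lt hp⟩ ∧ l = a ⟨p + 1, hp⟩) := by
          rintro ⟨rfl, rfl⟩
          exact absurd hkl.1 (not_lt.mpr (sw_inv_adj a p hp).le)
        have c2 : ¬ (k = a ⟨p + 1, hp⟩ ∧ l = a ⟨p, Nat.lt_of_succ_lt hp⟩) := by
          rintro ⟨rfl, rfl⟩
          exact absurd hkl.2 (not_lt.mpr h.le)
        refine ⟨?_, (sw_lt a p hp k l c1 c2).mp hkl.1, hkl.2⟩
        intro he
        exact c1 (Prod.mk.inj he)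
      have hcard := Finset.card_le_card hsub
      rw [Finset.card_erase_of_mem h1] at hcard
      exact Relation.ReflTransGen.head
        ⟨ha, ha', step_of_linExt P ω a hR hE hL p hp ha ha' hL'⟩
        (ih (sw a p hp) (by omega) hL' ha')

end PipeDream

/-- On the interval `[e, ω]` of the weak order, the pipe dream
congruence `≡_ω` coincides with the transitive closure of the rewriting rule
`U i j V ≡_ω U j i V` where `i < j` and `#{k ∈ U : k > i} ≥ #{k ∈ U : ω⁻¹ k < ω⁻¹ j}`:
two permutations `π, π' ∈ [e, ω]` satisfy `π ≡_ω π'` if and only if they are linked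
by a sequence of such rewritings (in either direction) staying inside `[e, ω]`. -/
theorem pdEquiv_iff_rewriting (n : ℕ) (ω : Equiv.Perm (Fin n))
    (π π' : Equiv.Perm (Fin n)) (hπ : WeakLE π ω) (hπ' : WeakLE π' ω) :
    PDEquiv ω π π' ↔
      Relation.ReflTransGen
        (fun a b => WeakLE a ω ∧ WeakLE b ω ∧ (RewStep ω a b ∨ RewStep ω b a))
        π π' := by
  constructor
  · rintro ⟨P, hR, hE, _, hL, hL'⟩
    exact PipeDream.chain P ω π' hR hE hL' hπ' _ π le_rfl hL hπ
  · intro h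
    obtain ⟨P, hR, hE, hL⟩ := PipeDream.exists_linExt n ω π hπ
    refine ⟨P, hR, hE, P.acyclic_of_linExt π hL, hL, ?_⟩
    clear hπ'
    induction h with
    | refl => exact hL
    | tail _ h1 ih => exact P.linExt_step ω _ _ hR hE ih h1.1 h1.2.1 h1.2.2
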